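/- (Impossibility of universal D-semifaithful coding for non-summable envelopes.) Let ρ be an unbounded distortion function that is consistent with respect to the Euclidean norm, and let f : X → [0,∞) with ∑_{x ∈ X} f(x) = ∞. Then for every d > 0, every n ≥ 1, and every D-semifaithful code ξ_n of length n operating at distortion d, sup_{μ ∈ Λ_f} [R(ξ_n, μ^n) − R_n(d, μ^n)] = +∞; more precisely, for every M > 0 there exists a finitely supported μ ∈ Λ_f with R_n(d, μ^n) < ∞ and R(ξ_n, μ^n) − R_n(d, μ^n) ≥ M. -/

import Mathlib

open Filter Topology
open scoped ENNReal NNReal BigOperators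

noncomputable section

/-- Block (single-letter) distortion `ρ_n` on `Fin n → α`. -/
def blockDist {α : Type*} (ρ : α → α → ℝ) (n : ℕ) (x y : Fin n → α) : ℝ :=
  (∑ i, ρ (x i) (y i)) / n

/-- `π` is a (countable) partition: nonempty cells, every point in exactly one cell. -/
def IsPartition {α : Type*} (π : Set (Set α)) : Prop :=
  (∀ s ∈ π, s.Nonempty) ∧ ∀ x : α, ∃! s, s ∈ π ∧ x ∈ s

/-- `Q_n(d)`: partitions whose every cell contains a prototype within distortion `d`. -/
def QPart {α : Type*} (ρ : α → α → ℝ) (n : ℕ) (d : ℝ) (π : Set (Set (Fin n → α))) : Prop :=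
  IsPartition π ∧ ∀ A ∈ π, ∃ y ∈ A, ∀ x ∈ A, blockDist ρ n x y ≤ d

/-- Measure of a set under a pmf. -/
def measOf {α : Type*} (p : α → ℝ≥0∞) (s : Set α) : ℝ≥0∞ := ∑' x : s, p x.1

/-- `entTerm t = t·log₂(1/t) ∈ [0,∞]`, with the convention `0·log 0 = 0`. -/
def entTerm (t : ℝ≥0∞) : ℝ≥0∞ := ENNReal.ofReal (-(t.toReal * Real.logb 2 t.toReal))

/-- Entropy of `p` restricted to the σ-field generated by the partition `π` (base 2). -/
def Hpart {α : Type*} (π : Set (Set α)) (p : α → ℝ≥0∞) : ℝ≥0∞ :=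
  ∑' A : π, entTerm (measOf p A.1)

/-- Shannon entropy of a pmf (base 2). -/
def Hent {α : Type*} (p : α → ℝ≥0∞) : ℝ≥0∞ := ∑' x, entTerm (p x)

/-- Nonnegative per-cell KL term `(a log(a/b) − a + b)/log 2`; summed over a partition and
probability vectors (`∑ a = ∑ b = 1`) this gives exactly `∑ a log₂(a/b) ∈ [0,∞]` with the
usual conventions (`0·log(0/q) = 0`, `p·log(p/0) = ∞` for `p > 0`). -/
def klTerm (a b : ℝ≥0∞) : ℝ≥0∞ :=
  if a = 0 then ENNReal.ofReal (b.toReal / Real.log 2)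
  else if b = 0 then ⊤
  else ENNReal.ofReal
    ((a.toReal * Real.log (a.toReal / b.toReal) - a.toReal + b.toReal) / Real.log 2)

/-- Divergence `D_{σ(π)}(p‖q) ∈ [0,∞]` restricted to the cells of `π` (base 2). -/
def Dpart {α : Type*} (π : Set (Set α)) (p q : α → ℝ≥0∞) : ℝ≥0∞ :=
  ∑' A : π, klTerm (measOf p A.1) (measOf q A.1)

/-- `p` is a probability mass function. -/
def IsPMF {α : Type*} (p : α → ℝ≥0∞) : Prop := ∑' a, p a = 1

/-- `n`-fold i.i.d. product pmf `μ^n`. -/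
def prodPMF {α : Type*} (p : α → ℝ≥0∞) (n : ℕ) : (Fin n → α) → ℝ≥0∞ :=
  fun x => ∏ i, p (x i)

/-- `Λ^n = {μ^n : μ ∈ Λ}`. -/
def prodFam {α : Type*} (Λ : Set (α → ℝ≥0∞)) (n : ℕ) : Set ((Fin n → α) → ℝ≥0∞) :=
  (fun μ => prodPMF μ n) '' Λ

/-- Operational rate `R_n(d, μ_n) = inf_{π ∈ Q_n(d)} H_{σ(π)}(μ_n)/n`. -/
def opRate {α : Type*} (ρ : α → α → ℝ) (n : ℕ) (d : ℝ) (μn : (Fin n → α) → ℝ≥0∞) : ℝ≥0∞ :=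
  ⨅ π ∈ {π | QPart ρ n d π}, Hpart π μn / (n : ℝ≥0∞)

/-- Kraft inequality for a codeword-length function on `B`. -/
def Kraft {β : Type*} (B : Set β) (ℓ : β → ℕ) : Prop :=
  (∑' y : B, (2⁻¹ : ℝ≥0∞) ^ ℓ y.1) ≤ 1

/-- D-semifaithful code `ξ_n = (φ, ℓ)` of length `n` operating at distortion `d`. -/
def IsCode {α : Type*} (ρ : α → α → ℝ) (n : ℕ) (d : ℝ)
    (φ : (Fin n → α) → Fin n → α) (ℓ : (Fin n → α) → ℕ) : Prop :=
  (∀ x, blockDist ρ n x (φ x) ≤ d) ∧ (∀ y ∈ Set.range φ, φ y = y) ∧ Kraft (Set.range φ) ℓ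

/-- Rate (bits per letter) of the code `(φ, ℓ)` under `μn`. -/
def codeRate {α : Type*} {n : ℕ} (φ : (Fin n → α) → Fin n → α) (ℓ : (Fin n → α) → ℕ)
    (μn : (Fin n → α) → ℝ≥0∞) : ℝ≥0∞ :=
  (∑' x, μn x * (ℓ (φ x) : ℝ≥0∞)) / (n : ℝ≥0∞)

/-- Partition of the block space induced by a quantizer. -/
def codePart {α : Type*} {n : ℕ} (φ : (Fin n → α) → Fin n → α) : Set (Set (Fin n → α)) :=
  {s | ∃ y ∈ Set.range φ, s = φ ⁻¹' {y}}

/-- Information radius `R⁺(Λn, σ(π)) = inf_v sup_{μn ∈ Λn} D_{σ(π)}(μn‖v)`. -/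
def Rplus {β : Type*} (Λn : Set (β → ℝ≥0∞)) (π : Set (Set β)) : ℝ≥0∞ :=
  ⨅ v : {v : β → ℝ≥0∞ // IsPMF v}, ⨆ μn ∈ Λn, Dpart π μn v.1

/-- A distortion function: nonnegative and positive off the diagonal. -/
def IsDistortion {α : Type*} (ρ : α → α → ℝ) : Prop :=
  (∀ x y, 0 ≤ ρ x y) ∧ ∀ x y, x ≠ y → 0 < ρ x y

/-- Unbounded distortion consistent w.r.t. the Euclidean norm on the alphabet ℕ. -/
def ConsistentUnbounded (ρ : ℕ → ℕ → ℝ) : Prop :=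
  ∀ K : ℝ, 0 < K → ∃ ε : ℝ, 0 < ε ∧ ∀ i j : ℕ, ε ≤ |(i : ℝ) - (j : ℝ)| → K ≤ ρ i j

/-- Envelope family `Λ_f`. -/
def envFam (f : ℕ → ℝ≥0) : Set (ℕ → ℝ≥0∞) :=
  {p | IsPMF p ∧ ∀ x, p x ≤ (f x : ℝ≥0∞)}

/-- Tail set `T_k = {k, k+1, ...}`. -/
def Tset (k : ℕ) : Set ℕ := {x | k ≤ x}

/-- Tail sum of the envelope `∑_{x ≥ k} f(x)`. -/
def tailF (f : ℕ → ℝ≥0) (k : ℕ) : ℝ≥0∞ := ∑' x : Tset k, (f x.1 : ℝ≥0∞)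

/-- `τ_f = min{k ≥ 1 : ∑_{x ≥ k} f(x) ≤ 1}`. -/
def tauF (f : ℕ → ℝ≥0) : ℕ := sInf {k | 1 ≤ k ∧ tailF f k ≤ 1}

/-- The envelope distribution `μ̃_f`. -/
def mutilde (f : ℕ → ℝ≥0) : ℕ → ℝ≥0∞ := fun x =>
  if tauF f ≤ x then (f x : ℝ≥0∞)
  else if x = tauF f - 1 then 1 - tailF f (tauF f)
  else 0

/-- `u_f(n) = min{k ≥ 1 : μ̃_f(T_{k+1}) < 1/n}`. -/
def ufn (f : ℕ → ℝ≥0) (n : ℕ) : ℕ :=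
  sInf {k | 1 ≤ k ∧ measOf (mutilde f) (Tset (k + 1)) < (n : ℝ≥0∞)⁻¹}

/-- Tail-partition entropy `H_{σ(π̃_k)}(p)` for the partition `π̃_k = {Γ_k, {k+1}, {k+2}, ...}`. -/
def Htail (k : ℕ) (p : ℕ → ℝ≥0∞) : ℝ≥0∞ :=
  entTerm (measOf p (Set.Iic k)) + ∑' x : Tset (k + 1), entTerm (p x.1)

lemma aux_prod_tsum (μ : ℕ → ℝ≥0∞) (hμ : ∑' a, μ a = 1) (n : ℕ) :
    ∑' x, prodPMF μ n x = 1 := by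
  induction n with
  | zero => simp [prodPMF]
  | succ n ih =>
    rw [← (Fin.consEquiv (fun _ : Fin (n + 1) => ℕ)).tsum_eq, ENNReal.tsum_prod']
    have : ∀ a : ℕ, ∀ b : Fin n → ℕ,
        prodPMF μ (n + 1) ((Fin.consEquiv (fun _ : Fin (n + 1) => ℕ)) (a, b))
          = μ a * prodPMF μ n b := by
      intro a b
      simp [prodPMF, Fin.prod_univ_succ, Fin.consEquiv]
    simp_rw [this, ENNReal.tsum_mul_left, ih, mul_one, hμ]

lemma aux_real (r : ℝ) (hr : 0 < r) (N l : ℕ) :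
    -(r * Real.logb 2 r) + r * N + r * (1 / Real.log 2)
      ≤ r * l + 2 ^ N * 2⁻¹ ^ l * (1 / Real.log 2) := by
  have hl2 : 0 < Real.log 2 := Real.log_pos (by norm_num)
  set t : ℝ := 2 ^ N * 2⁻¹ ^ l with ht
  have htp : 0 < t := by positivity
  have h1 : Real.log (t / r) ≤ t / r - 1 := Real.log_le_sub_one_of_pos (by positivity)
  have h2 : Real.log (t / r) = N * Real.log 2 - l * Real.log 2 - Real.log r := by
    rw [Real.log_div htp.ne' hr.ne', ht, Real.log_mul (by positivity) (by positivity),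
      Real.log_pow, Real.log_pow, Real.log_inv]
    ring
  rw [h2] at h1
  have h3 := mul_le_mul_of_nonneg_left h1 hr.le
  have h4 : r * (t / r - 1) = t - r := by field_simp
  rw [h4] at h3
  rw [Real.logb, ← sub_nonneg]
  have : r * l + t * (1 / Real.log 2)
      - (-(r * (Real.log r / Real.log 2)) + r * N + r * (1 / Real.log 2))
      = (t - r - r * (N * Real.log 2 - l * Real.log 2 - Real.log r)) / Real.log 2 := by
    field_simp
    ring
  rw [this]
  exact div_nonneg (by linarith) hl2.le

lemma aux_term (p : ℝ≥0∞) (hp0 : p ≠ 0) (hp : p ≤ 1) (N l : ℕ) :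
    entTerm p + p * N + p * ENNReal.ofReal (1 / Real.log 2)
      ≤ p * l + 2 ^ N * 2⁻¹ ^ l * ENNReal.ofReal (1 / Real.log 2) := by
  have hpt : p ≠ ⊤ := ne_top_of_le_ne_top ENNReal.one_ne_top hp
  have hl2 : 0 < Real.log 2 := Real.log_pos (by norm_num)
  obtain ⟨r, hr, rfl⟩ : ∃ r : ℝ, 0 < r ∧ p = ENNReal.ofReal r :=
    ⟨p.toReal, ENNReal.toReal_pos hp0 hpt, (ENNReal.ofReal_toReal hpt).symm⟩
  have hr1 : r ≤ 1 := ENNReal.ofReal_le_one.1 hp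
  have hC : 0 ≤ 1 / Real.log 2 := by positivity
  have e2 : (2 : ℝ≥0∞) = ENNReal.ofReal 2 := by simp
  have e3 : (2⁻¹ : ℝ≥0∞) = ENNReal.ofReal 2⁻¹ := by
    rw [ENNReal.ofReal_inv_of_pos (by norm_num)]; simp
  have hlog : Real.logb 2 r ≤ 0 := Real.logb_nonpos (by norm_num) hr.le hr1
  have hent : 0 ≤ -(r * Real.logb 2 r) := by nlinarith
  rw [entTerm, ENNReal.toReal_ofReal hr.le, e3, e2, ← ENNReal.ofReal_natCast N,
    ← ENNReal.ofReal_natCast l, ← ENNReal.ofReal_pow (by norm_num),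
    ← ENNReal.ofReal_pow (by norm_num), ← ENNReal.ofReal_mul hr.le, ← ENNReal.ofReal_mul hr.le,
    ← ENNReal.ofReal_mul hr.le, ← ENNReal.ofReal_mul (by positivity),
    ← ENNReal.ofReal_mul (by positivity), ← ENNReal.ofReal_add hent (by positivity),
    ← ENNReal.ofReal_add (by positivity) (by positivity),
    ← ENNReal.ofReal_add (by positivity) (by positivity)]
  exact ENNReal.ofReal_le_ofReal (aux_real r hr N l)

/-- A finitely supported pmf below a nonsummable envelope, supported on `[k, ∞)`. -/
lemma aux_exists_pmf (f : ℕ → ℝ≥0) (hf : (∑' x, (f x : ℝ≥0∞)) = ⊤) (k : ℕ) :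
    ∃ μ ∈ envFam f, {x | μ x ≠ 0}.Finite ∧ ∀ x < k, μ x = 0 := by
  have hs : ∃ s : Finset ℕ, (∑ x ∈ Finset.range k, (f x : ℝ≥0∞)) + 1
      < ∑ x ∈ s, (f x : ℝ≥0∞) := by
    rw [ENNReal.tsum_eq_iSup_sum] at hf
    have : (∑ x ∈ Finset.range k, (f x : ℝ≥0∞)) + 1 < ⨆ s : Finset ℕ, ∑ x ∈ s, (f x : ℝ≥0∞) := by
      rw [hf]
      exact ENNReal.add_lt_top.2 ⟨ENNReal.sum_lt_top.2 fun _ _ => ENNReal.coe_lt_top, by simp⟩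
    exact lt_iSup_iff.1 this
  obtain ⟨s, hs⟩ := hs
  set F := s \ Finset.range k with hF
  set Z : ℝ≥0∞ := ∑ x ∈ F, (f x : ℝ≥0∞) with hZ
  have hfin : (∑ x ∈ Finset.range k, (f x : ℝ≥0∞)) ≠ ⊤ :=
    (ENNReal.sum_lt_top.2 fun _ _ => ENNReal.coe_lt_top).ne
  have hZ1 : 1 ≤ Z := by
    have h1 : ∑ x ∈ s, (f x : ℝ≥0∞) ≤ (∑ x ∈ Finset.range k, (f x : ℝ≥0∞)) + Z := by
      rw [hZ, ← Finset.sum_union Finset.disjoint_sdiff, Finset.union_sdiff_self_eq_union]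
      exact Finset.sum_le_sum_of_subset Finset.subset_union_right
    exact (ENNReal.add_le_add_iff_left hfin).1 (hs.le.trans h1)
  have hZt : Z ≠ ⊤ := (ENNReal.sum_lt_top.2 fun _ _ => ENNReal.coe_lt_top).ne
  have hZ0 : Z ≠ 0 := (lt_of_lt_of_le one_pos hZ1).ne'
  refine ⟨fun x => if x ∈ F then (f x : ℝ≥0∞) * Z⁻¹ else 0, ⟨?_, ?_⟩, ?_, ?_⟩
  · unfold IsPMF
    rw [tsum_eq_sum (s := F) (fun x hx => by simp [hx]),
      Finset.sum_congr rfl (fun x hx => if_pos hx), ← Finset.sum_mul]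
    exact ENNReal.mul_inv_cancel hZ0 hZt
  · intro x
    dsimp only
    split_ifs
    · exact mul_le_of_le_one_right' (ENNReal.inv_le_one.2 hZ1)
    · simp
  · refine F.finite_toSet.subset fun x hx => ?_
    by_contra h
    exact hx (if_neg h)
  · intro x hx
    refine if_neg ?_
    simp [hF, hx]

lemma aux_main (ρ : ℕ → ℕ → ℝ) (hρ : IsDistortion ρ)
    (hcons : ConsistentUnbounded ρ)
    (f : ℕ → ℝ≥0) (hf : (∑' x, (f x : ℝ≥0∞)) = ⊤)
    (d : ℝ) (hd : 0 < d) (n : ℕ) (hn : 1 ≤ n)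
    (φ : (Fin n → ℕ) → Fin n → ℕ) (ℓ : (Fin n → ℕ) → ℕ)
    (hcode : IsCode ρ n d φ ℓ) (N : ℕ) :
    ∃ μ ∈ envFam f, {x | μ x ≠ 0}.Finite ∧
      (∑' x, prodPMF μ n x * (ℓ (φ x) : ℝ≥0∞)) ≠ ⊤ ∧
      Hpart (codePart φ) (prodPMF μ n) + N ≤ ∑' x, prodPMF μ n x * (ℓ (φ x) : ℝ≥0∞) := by
  classical
  obtain ⟨hdist, hid, hkraft⟩ := hcode
  have hnp : (0 : ℝ) < n := by exact_mod_cast hn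
  obtain ⟨ε, hε, hcons⟩ := hcons (n * d + 1) (by positivity)
  have hclose : ∀ x i, |(x i : ℝ) - (φ x i : ℝ)| < ε := by
    intro x i
    by_contra h
    have h1 := hcons _ _ (not_lt.1 h)
    have h2 := hdist x
    rw [blockDist, div_le_iff₀ hnp] at h2
    have h3 : ρ (x i) (φ x i) ≤ ∑ i, ρ (x i) (φ x i) :=
      Finset.single_le_sum (f := fun i => ρ (x i) (φ x i)) (fun _ _ => hρ.1 _ _)
        (Finset.mem_univ i)
    linarith
  let i0 : Fin n := ⟨0, hn⟩
  -- small tail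
  obtain ⟨T, hT⟩ : ∃ T : Finset (Set.range φ),
      ∑' y : {y // y ∉ T}, (2⁻¹ : ℝ≥0∞) ^ ℓ y.1.1 < 2⁻¹ ^ N := by
    have h := ENNReal.tendsto_tsum_compl_atTop_zero
      (f := fun y : Set.range φ => (2⁻¹ : ℝ≥0∞) ^ ℓ y.1)
      (ne_top_of_le_ne_top ENNReal.one_ne_top hkraft)
    exact (h.eventually (gt_mem_nhds (ENNReal.pow_pos (by simp) N))).exists
  obtain ⟨m, hm⟩ : ∃ m : ℕ, ∀ y ∈ T, y.1 i0 ≤ m :=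
    ⟨T.sup fun y => y.1 i0, fun y hy => Finset.le_sup (f := fun y : Set.range φ => y.1 i0) hy⟩
  obtain ⟨e, he⟩ := exists_nat_ge ε
  obtain ⟨μ, hμ, hμfin, hμ0⟩ := aux_exists_pmf f hf (m + e)
  refine ⟨μ, hμ, hμfin, ?_, ?_⟩
  · rw [tsum_eq_sum (s := Fintype.piFinset fun _ : Fin n => hμfin.toFinset)]
    · refine (ENNReal.sum_lt_top.2 fun x _ => ENNReal.mul_lt_top ?_ (by simp)).ne
      refine ENNReal.prod_lt_top fun i _ => ?_
      exact (hμ.2 _).trans_lt ENNReal.coe_lt_top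
    · intro x hx
      simp only [Fintype.mem_piFinset, Set.Finite.mem_toFinset, Set.mem_ofPred_eq, not_forall,
        not_not] at hx
      obtain ⟨i, hi⟩ := hx
      rw [prodPMF, Finset.prod_eq_zero (Finset.mem_univ i) hi, zero_mul]
  set P := prodPMF μ n with hP
  have hP1 : ∑' x, P x = 1 := aux_prod_tsum μ hμ.1 n
  set g := Set.rangeFactorization φ with hg
  set p : Set.range φ → ℝ≥0∞ := fun y => ∑' x : g ⁻¹' {y}, P x.1 with hp
  have hpsum : ∑' y, p y = 1 := by rw [hp, ENNReal.tsum_fiberwise, hP1]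
  have hp1 : ∀ y, p y ≤ 1 := fun y => hpsum ▸ ENNReal.le_tsum y
  have hE : ∑' x, P x * (ℓ (φ x) : ℝ≥0∞) = ∑' y, p y * (ℓ y.1 : ℝ≥0∞) := by
    rw [← ENNReal.tsum_fiberwise _ g]
    refine tsum_congr fun y => ?_
    rw [hp, ← ENNReal.tsum_mul_right]
    refine tsum_congr fun x => ?_
    have hx : φ x.1 = y.1 := congrArg Subtype.val (show g x.1 = y from x.2)
    rw [hx]
  have hpT : ∀ y ∈ T, p y = 0 := by
    intro y hy
    rw [hp, ENNReal.tsum_eq_zero]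
    rintro ⟨x, hx⟩
    have hx' : φ x = y.1 := congrArg Subtype.val (show g x = y from hx)
    refine Finset.prod_eq_zero (Finset.mem_univ i0) (hμ0 _ ?_)
    have h1 := hclose x i0
    rw [hx'] at h1
    have h2 : (x i0 : ℝ) < (m : ℝ) + e := by
      have h3 : ((y.1 i0 : ℕ) : ℝ) ≤ m := by exact_mod_cast hm y hy
      have := (abs_lt.1 h1).2
      linarith
    exact_mod_cast h2
  have hH : Hpart (codePart φ) P ≤ ∑' y, entTerm (p y) := by
    have hch : ∀ A : codePart φ, ∃ y : Set.range φ, A.1 = g ⁻¹' {y} := by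
      rintro ⟨A, y, hy, rfl⟩
      refine ⟨⟨y, hy⟩, ?_⟩
      ext x
      simp [hg, Set.rangeFactorization, Subtype.ext_iff]
    choose c hc using hch
    have hinj : Function.Injective c := fun A B h => by
      apply Subtype.ext
      rw [hc A, hc B, h]
    refine le_trans (le_of_eq ?_) (ENNReal.tsum_comp_le_tsum_of_injective hinj _)
    refine tsum_congr fun A => ?_
    rw [measOf, hc A]
  set C := ENNReal.ofReal (1 / Real.log 2) with hC
  have hterm : ∀ y, entTerm (p y) + p y * N + p y * C ≤
      p y * (ℓ y.1 : ℝ≥0∞) +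
        Set.indicator {y | y ∉ T} (fun y => 2 ^ N * (2⁻¹ : ℝ≥0∞) ^ ℓ y.1 * C) y := by
    intro y
    by_cases h0 : p y = 0
    · simp [h0, entTerm]
    · have : y ∈ {y | y ∉ T} := fun h => h0 (hpT y h)
      rw [Set.indicator_of_mem this]
      exact aux_term _ h0 (hp1 y) _ _
  have hsum := ENNReal.tsum_le_tsum hterm
  rw [ENNReal.tsum_add, ENNReal.tsum_add, ENNReal.tsum_add, ENNReal.tsum_mul_right,
    ENNReal.tsum_mul_right, hpsum, one_mul, one_mul, ← hE, ← tsum_subtype,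
    ENNReal.tsum_mul_right, ENNReal.tsum_mul_left] at hsum
  have hQ : 2 ^ N * (∑' y : {y | y ∉ T}, (2⁻¹ : ℝ≥0∞) ^ ℓ y.1.1) * C ≤ C := by
    refine mul_le_of_le_one_left' ?_
    refine (mul_le_mul_right hT.le _).trans ?_
    rw [← mul_pow, ENNReal.mul_inv_cancel (by simp) (by simp), one_pow]
  have hfinal := hsum.trans (add_le_add_right hQ _)
  have := (ENNReal.add_le_add_iff_right (ENNReal.ofReal_ne_top)).1 hfinal
  exact (add_le_add_left hH _).trans this

lemma aux_QPart (ρ : ℕ → ℕ → ℝ) (d : ℝ) (n : ℕ)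
    (φ : (Fin n → ℕ) → Fin n → ℕ) (ℓ : (Fin n → ℕ) → ℕ)
    (hcode : IsCode ρ n d φ ℓ) : QPart ρ n d (codePart φ) := by
  obtain ⟨hdist, hid, -⟩ := hcode
  refine ⟨⟨?_, ?_⟩, ?_⟩
  · rintro s ⟨y, hy, rfl⟩
    exact ⟨y, hid y hy⟩
  · intro x
    refine ⟨φ ⁻¹' {φ x}, ⟨⟨φ x, ⟨x, rfl⟩, rfl⟩, rfl⟩, ?_⟩
    rintro s ⟨⟨y, hy, rfl⟩, hx⟩
    have : φ x = y := hx
    rw [this]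
  · rintro s ⟨y, hy, rfl⟩
    refine ⟨y, hid y hy, fun x hx => ?_⟩
    have : φ x = y := hx
    exact this ▸ hdist x

/-- Impossibility for non-summable envelopes: if `ρ` is an unbounded distortion
consistent with the Euclidean norm and `∑_x f(x) = ∞`, then for every `d > 0`, `n ≥ 1`, and
every D-semifaithful code `ξ_n` at distortion `d`,
`sup_{μ ∈ Λ_f}[R(ξ_n, μ^n) − R_n(d, μ^n)] = ∞`; more precisely, for every `M` there is a
finitely supported `μ ∈ Λ_f` with `R_n(d, μ^n) < ∞` and `R(ξ_n, μ^n) − R_n(d, μ^n) ≥ M`. -/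
theorem impossibility_nonsummable (ρ : ℕ → ℕ → ℝ) (hρ : IsDistortion ρ)
    (hcons : ConsistentUnbounded ρ)
    (f : ℕ → ℝ≥0) (hf : (∑' x, (f x : ℝ≥0∞)) = ⊤)
    (d : ℝ) (hd : 0 < d) (n : ℕ) (hn : 1 ≤ n)
    (φ : (Fin n → ℕ) → Fin n → ℕ) (ℓ : (Fin n → ℕ) → ℕ)
    (hcode : IsCode ρ n d φ ℓ) :
    (⨆ μ ∈ envFam f, (codeRate φ ℓ (prodPMF μ n) - opRate ρ n d (prodPMF μ n))) = ⊤ ∧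
    ∀ M : ℝ, ∃ μ ∈ envFam f, {x | μ x ≠ 0}.Finite ∧
      opRate ρ n d (prodPMF μ n) ≠ ⊤ ∧
      ENNReal.ofReal M ≤ codeRate φ ℓ (prodPMF μ n) - opRate ρ n d (prodPMF μ n) := by
  have key : ∀ M : ℝ, ∃ μ ∈ envFam f, {x | μ x ≠ 0}.Finite ∧
      opRate ρ n d (prodPMF μ n) ≠ ⊤ ∧
      ENNReal.ofReal M ≤ codeRate φ ℓ (prodPMF μ n) - opRate ρ n d (prodPMF μ n) := by
    intro M
    have hn0 : (n : ℝ≥0∞) ≠ 0 := by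
      simp only [ne_eq, Nat.cast_eq_zero]
      omega
    have hnt : (n : ℝ≥0∞) ≠ ⊤ := ENNReal.natCast_ne_top n
    obtain ⟨K, hK⟩ := exists_nat_ge M
    obtain ⟨μ, hμ, hfin, hE, hH⟩ := aux_main ρ hρ hcons f hf d hd n hn φ ℓ hcode (K * n)
    have hop : opRate ρ n d (prodPMF μ n) ≤ Hpart (codePart φ) (prodPMF μ n) / n :=
      iInf₂_le (codePart φ) (aux_QPart ρ d n φ ℓ hcode)
    have hHt : Hpart (codePart φ) (prodPMF μ n) / n ≠ ⊤ :=
      ENNReal.div_ne_top (ne_top_of_le_ne_top hE (le_self_add.trans hH)) hn0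
    refine ⟨μ, hμ, hfin, ne_top_of_le_ne_top hHt hop, ?_⟩
    have h1 : ENNReal.ofReal M ≤ K := by
      rw [← ENNReal.ofReal_natCast]
      exact ENNReal.ofReal_le_ofReal hK
    refine h1.trans (le_trans ?_ (tsub_le_tsub_left hop _))
    refine ENNReal.le_sub_of_add_le_left hHt ?_
    have h2 := ENNReal.div_le_div_right hH (n : ℝ≥0∞)
    rw [ENNReal.add_div, Nat.cast_mul, ENNReal.mul_div_cancel_right hn0 hnt] at h2
    exact h2
  refine ⟨?_, key⟩
  refine ENNReal.eq_top_of_forall_nnreal_le fun r => ?_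
  obtain ⟨μ, hμ, -, -, h⟩ := key r
  rw [ENNReal.ofReal_coe_nnreal] at h
  exact h.trans (le_iSup₂ (f := fun μ (_ : μ ∈ envFam f) =>
    codeRate φ ℓ (prodPMF μ n) - opRate ρ n d (prodPMF μ n)) μ hμ)
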